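/- arXiv:2408.03976 — 4 statements merged into one kernel-verified Lean document; each statement's English description precedes it below -/
import Mathlib

section
/- Let G be a finite graph with n = |V(G)| ≥ 2 vertices and let P_r be the path on r ≥ 3 vertices. Then μ_{r+1}(P_r ⊙ G) = μ(P_r ⊙ G) = r·n, where r + 1 is the diameter of the corona product P_r ⊙ G. -/
open SimpleGraph

/-- Two vertices `x, y` are `S_k`-visible in `G`: there is a shortest `x,y`-path of length
at most `k` none of whose internal vertices lies in `S`. -/
def SKVisible {V : Type*} (G : SimpleGraph V) (S : Set V) (k : ℕ) (x y : V) : Prop :=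
  ∃ p : G.Walk x y, p.IsPath ∧ p.length = G.dist x y ∧ p.length ≤ k ∧
    ∀ v ∈ p.support, v ∈ S → v = x ∨ v = y

/-- `S` is a `k`-distance mutual-visibility set of `G`. -/
def IsKDistMutualVisSet {V : Type*} (G : SimpleGraph V) (k : ℕ) (S : Set V) : Prop :=
  ∀ ⦃x⦄, x ∈ S → ∀ ⦃y⦄, y ∈ S → SKVisible G S k x y

/-- The `k`-distance mutual-visibility number `μ_k(G)`. -/
noncomputable def kdistMu {V : Type*} (G : SimpleGraph V) (k : ℕ) : ℕ :=
  sSup {n | ∃ S : Finset V, IsKDistMutualVisSet G k ↑S ∧ S.card = n}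

/-- Two vertices `x, y` are `S`-visible in `G`. -/
def SVisible {V : Type*} (G : SimpleGraph V) (S : Set V) (x y : V) : Prop :=
  ∃ p : G.Walk x y, p.IsPath ∧ p.length = G.dist x y ∧
    ∀ v ∈ p.support, v ∈ S → v = x ∨ v = y

/-- `S` is a mutual-visibility set of `G`. -/
def IsMutualVisSet {V : Type*} (G : SimpleGraph V) (S : Set V) : Prop :=
  ∀ ⦃x⦄, x ∈ S → ∀ ⦃y⦄, y ∈ S → SVisible G S x y

/-- The mutual-visibility number `μ(G)`. -/
noncomputable def mutualVisNum {V : Type*} (G : SimpleGraph V) : ℕ :=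
  sSup {n | ∃ S : Finset V, IsMutualVisSet G ↑S ∧ S.card = n}

/-- The corona product `G ⊙ H`: one copy of `G` together with a copy of `H` for each vertex
`a` of `G`, joining `a` to every vertex of its copy of `H`. -/
def corona {α β : Type*} (G : SimpleGraph α) (H : SimpleGraph β) :
    SimpleGraph (α ⊕ (α × β)) :=
  SimpleGraph.fromRel (fun x y =>
    (∃ a a' : α, x = Sum.inl a ∧ y = Sum.inl a' ∧ G.Adj a a') ∨
    (∃ (a : α) (b : β), x = Sum.inl a ∧ y = Sum.inr (a, b)) ∨
    (∃ (a : α) (b b' : β), x = Sum.inr (a, b) ∧ y = Sum.inr (a, b') ∧ H.Adj b b'))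

section Corona

variable {α β : Type*} {G : SimpleGraph α} {H : SimpleGraph β}

@[simp] theorem corona_adj_inl_inl {a a' : α} :
    (corona G H).Adj (.inl a) (.inl a') ↔ G.Adj a a' := by
  simp only [corona, SimpleGraph.fromRel_adj]
  constructor
  · rintro ⟨-, (⟨_, _, h₁, h₂, h⟩ | ⟨_, _, -, h⟩ | ⟨_, _, _, h, -⟩) |
      (⟨_, _, h₁, h₂, h⟩ | ⟨_, _, -, h⟩ | ⟨_, _, _, h, -⟩)⟩ <;> simp_all [G.adj_comm]
  · intro h
    exact ⟨by simpa using h.ne, .inl (.inl ⟨a, a', rfl, rfl, h⟩)⟩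

@[simp] theorem corona_adj_inl_inr {a a' : α} {b : β} :
    (corona G H).Adj (.inl a) (.inr (a', b)) ↔ a = a' := by
  simp [corona, SimpleGraph.fromRel_adj, eq_comm]

@[simp] theorem corona_adj_inr_inl {a a' : α} {b : β} :
    (corona G H).Adj (.inr (a', b)) (.inl a) ↔ a = a' := by
  rw [SimpleGraph.adj_comm, corona_adj_inl_inr]

@[simp] theorem corona_adj_inr_inr {a a' : α} {b b' : β} :
    (corona G H).Adj (.inr (a, b)) (.inr (a', b')) ↔ a = a' ∧ H.Adj b b' := by
  simp only [corona, SimpleGraph.fromRel_adj]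
  constructor
  · rintro ⟨-, (⟨_, _, h, -⟩ | ⟨_, _, h, -⟩ | ⟨_, _, _, h₁, h₂, h⟩) |
      (⟨_, _, h, -⟩ | ⟨_, _, h, -⟩ | ⟨_, _, _, h₁, h₂, h⟩)⟩ <;> simp_all [H.adj_comm]
  · rintro ⟨rfl, h⟩
    exact ⟨by simpa using h.ne, .inl (.inr (.inr ⟨a, b, b', rfl, rfl, h⟩))⟩

/-- The vertex of `G` over which a vertex of `corona G H` lies. -/
def coronaBase : α ⊕ (α × β) → α := Sum.elim id Prod.fst

/-- A walk leaving the copy of `H` at `a` passes through `a`. -/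
theorem inl_mem_support_of_coronaBase_ne {a : α} {b : β} {z : α ⊕ (α × β)}
    (p : (corona G H).Walk (.inr (a, b)) z) (hz : coronaBase z ≠ a) :
    Sum.inl a ∈ p.support := by
  obtain ⟨d, hd, ⟨b', hb'⟩, h⟩ := p.exists_boundary_dart
    (Set.range fun b : β => Sum.inr (a, b)) ⟨b, rfl⟩ (by rintro ⟨b', rfl⟩; exact hz rfl)
  have hadj := d.adj
  have hmem := p.dart_snd_mem_support_of_mem_darts hd
  rw [← hb'] at hadj
  rcases hs : d.snd with c | ⟨c, b''⟩
  · rw [hs] at hadj hmem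
    rwa [corona_adj_inr_inl.1 hadj] at hmem
  · rw [hs] at hadj
    exact absurd ⟨b'', by rw [hs, (corona_adj_inr_inr.1 hadj).1]⟩ h

/-- A mutual-visibility set containing `a` and a vertex of the copy of `H` at `a` lies
over `a`. -/
theorem IsMutualVisSet.coronaBase_eq {S : Set (α ⊕ (α × β))} (hS : IsMutualVisSet (corona G H) S)
    {a : α} {b : β} (ha : Sum.inl a ∈ S) (hb : Sum.inr (a, b) ∈ S) {z : α ⊕ (α × β)}
    (hz : z ∈ S) : coronaBase z = a := by
  by_contra hne
  obtain ⟨p, -, -, h⟩ := hS hb hz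
  rcases h _ (inl_mem_support_of_coronaBase_ne p hne) ha with h | h
  · cases h
  · exact hne (h ▸ rfl)

theorem IsMutualVisSet.card_le_corona [Fintype α] [Fintype β] (hα : 2 ≤ Fintype.card α)
    (hβ : 1 ≤ Fintype.card β) {S : Finset (α ⊕ (α × β))}
    (hS : IsMutualVisSet (corona G H) (S : Set (α ⊕ (α × β)))) :
    S.card ≤ Fintype.card α * Fintype.card β := by
  classical
  have hcopy (a : α) : (Finset.univ.image fun b : β => (Sum.inr (a, b) : α ⊕ (α × β))).card ≤
      Fintype.card β := Finset.card_image_le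
  by_cases h : ∃ a b, Sum.inl a ∈ S ∧ Sum.inr (a, b) ∈ S
  · obtain ⟨a, b, ha, hb⟩ := h
    have hsub : S ⊆ insert (Sum.inl a) (Finset.univ.image fun b : β => Sum.inr (a, b)) := by
      intro z hz
      have := hS.coronaBase_eq ha hb hz
      rcases z with c | ⟨c, b'⟩ <;> simp_all [coronaBase]
    have h₁ := (Finset.card_le_card hsub).trans (Finset.card_insert_le _ _)
    have := hcopy a
    nlinarith
  · push Not at h
    rw [mul_comm]
    refine Finset.card_le_mul_card_image_of_maps_to (f := coronaBase) (t := Finset.univ)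
      (by simp) _ fun a _ => ?_
    by_cases ha : Sum.inl a ∈ S
    · refine (Finset.card_le_card (t := {Sum.inl a}) ?_).trans hβ
      intro z hz
      rcases z with c | ⟨c, b⟩
      · simpa [coronaBase] using (Finset.mem_filter.1 hz).2
      · obtain ⟨hzS, rfl⟩ := Finset.mem_filter.1 hz
        exact (h _ _ ha hzS).elim
    · refine (Finset.card_le_card ?_).trans (hcopy a)
      intro z hz
      rcases z with c | ⟨c, b⟩
      · obtain ⟨hzS, rfl⟩ := Finset.mem_filter.1 hz
        exact (ha hzS).elim
      · simpa [coronaBase, eq_comm] using (Finset.mem_filter.1 hz).2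

theorem exists_walk_inl_length_le_one (x : α ⊕ (α × β)) :
    ∃ p : (corona G H).Walk x (.inl (coronaBase x)), p.length ≤ 1 := by
  rcases x with a | ⟨a, b⟩
  · exact ⟨.nil, Nat.zero_le _⟩
  · exact ⟨(corona_adj_inr_inl.2 rfl).toWalk, le_rfl⟩

end Corona

theorem SVisible.symm {V : Type*} {G : SimpleGraph V} {S : Set V} {x y : V}
    (h : SVisible G S x y) : SVisible G S y x := by
  obtain ⟨p, hp, hl, hs⟩ := h
  exact ⟨p.reverse, hp.reverse, by rw [p.length_reverse, hl, SimpleGraph.dist_comm],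
    fun v hv hvS => (hs v (by simpa using hv) hvS).symm⟩

theorem kdistMu_diam {V : Type*} {G : SimpleGraph V} (hG : G.ediam ≠ ⊤) :
    kdistMu G G.diam = mutualVisNum G := by
  have hvis (S : Set V) (x y : V) : SKVisible G S G.diam x y ↔ SVisible G S x y :=
    ⟨fun ⟨p, hp, hl, _, hs⟩ => ⟨p, hp, hl, hs⟩,
      fun ⟨p, hp, hl, hs⟩ => ⟨p, hp, hl, hl ▸ dist_le_diam hG, hs⟩⟩
  simp only [kdistMu, mutualVisNum, IsKDistMutualVisSet, IsMutualVisSet, hvis]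

theorem SimpleGraph.Walk.le_add_length_of_adj {V : Type*} {G : SimpleGraph V} (φ : V → ℕ)
    (hφ : ∀ u v, G.Adj u v → φ v ≤ φ u + 1) {u v : V} (p : G.Walk u v) :
    φ v ≤ φ u + p.length := by
  induction p with
  | nil => simp
  | cons h p ih =>
    have := hφ _ _ h
    rw [Walk.length_cons]
    omega

section CoronaPath

variable {W : Type*} {G : SimpleGraph W} {r : ℕ}

theorem exists_walk_inl_inl {i j : Fin r} (hij : i ≤ j) :
    ∃ p : (corona (pathGraph r) G).Walk (.inl i) (.inl j),
      p.length = j.val - i.val ∧ ∀ v ∈ p.support, v ∈ Set.range Sum.inl := by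
  obtain ⟨i, hi⟩ := i
  obtain ⟨j, hj⟩ := j
  simp only [Fin.mk_le_mk] at hij
  induction j, hij using Nat.le_induction with
  | base => exact ⟨.nil, by simp⟩
  | succ j hij ih =>
    obtain ⟨p, hl, hs⟩ := ih (by omega)
    have hadj : (corona (pathGraph r) G).Adj (.inl ⟨j, by omega⟩) (.inl ⟨j + 1, hj⟩) := by
      simp [pathGraph_adj]
    refine ⟨p.concat hadj, ?_, fun v hv => ?_⟩
    · rw [Walk.length_concat, hl]
      simp only
      omega
    · rw [Walk.support_concat, List.mem_append] at hv
      rcases hv with hv | hv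
      · exact hs v hv
      · exact ⟨_, (List.mem_singleton.1 hv).symm⟩

theorem exists_walk_inl_inl_length_lt (i j : Fin r) :
    ∃ p : (corona (pathGraph r) G).Walk (.inl i) (.inl j), p.length < r := by
  rcases le_total i j with h | h
  · obtain ⟨p, hp, -⟩ := exists_walk_inl_inl (G := G) h
    exact ⟨p, by omega⟩
  · obtain ⟨p, hp, -⟩ := exists_walk_inl_inl (G := G) h
    exact ⟨p.reverse, by rw [p.length_reverse]; omega⟩

theorem sub_add_two_le_length {i j : Fin r} (hij : i < j) {w w' : W}
    (p : (corona (pathGraph r) G).Walk (.inr (i, w)) (.inr (j, w'))) :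
    j.val - i.val + 2 ≤ p.length := by
  have h := p.le_add_length_of_adj
    (Sum.elim (fun k => k.val + 1) fun q => if q.1 ≤ i then q.1.val else q.1.val + 2) <| by
      rintro (a | ⟨a, b⟩) (a' | ⟨a', b'⟩) h
      · have := pathGraph_adj.1 (corona_adj_inl_inl.1 h)
        simp only [Sum.elim_inl]
        omega
      · obtain rfl := corona_adj_inl_inr.1 h
        simp only [Sum.elim_inl, Sum.elim_inr]
        split <;> omega
      · obtain rfl := corona_adj_inr_inl.1 h
        simp only [Sum.elim_inl, Sum.elim_inr]
        split <;> omega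
      · obtain ⟨rfl, -⟩ := corona_adj_inr_inr.1 h
        simp
  simp only [Sum.elim_inr, le_refl, if_true, if_neg hij.not_ge] at h
  omega

/-- Two vertices in different copies of `G` are joined by a shortest path meeting no other
vertex of a copy of `G`. -/
theorem exists_walk_inr_inr {i j : Fin r} (hij : i < j) (w w' : W) :
    ∃ p : (corona (pathGraph r) G).Walk (.inr (i, w)) (.inr (j, w')),
      p.length = j.val - i.val + 2 ∧
      p.length = (corona (pathGraph r) G).dist (.inr (i, w)) (.inr (j, w')) ∧
      ∀ v ∈ p.support, v ∈ Set.range Sum.inr → v = .inr (i, w) ∨ v = .inr (j, w') := by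
  obtain ⟨p, hl, hs⟩ := exists_walk_inl_inl (G := G) hij.le
  have hi : (corona (pathGraph r) G).Adj (.inr (i, w)) (.inl i) := corona_adj_inr_inl.2 rfl
  have hj : (corona (pathGraph r) G).Adj (.inl j) (.inr (j, w')) := corona_adj_inl_inr.2 rfl
  have hlen : (Walk.cons hi (p.concat hj)).length = j.val - i.val + 2 := by
    rw [Walk.length_cons, Walk.length_concat, hl]
  refine ⟨.cons hi (p.concat hj), hlen, le_antisymm ?_ (dist_le _), fun v hv hvS => ?_⟩
  · obtain ⟨q, hq⟩ := (Walk.cons hi (p.concat hj)).reachable.exists_walk_length_eq_dist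
    rw [← hq, hlen]
    exact sub_add_two_le_length hij q
  · rw [Walk.support_cons, Walk.support_concat, List.mem_cons, List.mem_append,
      List.mem_singleton] at hv
    rcases hv with hv | hv | hv
    · exact .inl hv
    · obtain ⟨_, rfl⟩ := hs v hv
      simp at hvS
    · exact .inr hv

theorem isMutualVisSet_range_inr :
    IsMutualVisSet (corona (pathGraph r) G) (Set.range Sum.inr) := by
  have hlt {i j : Fin r} (hij : i < j) (w w' : W) :
      SVisible (corona (pathGraph r) G) (Set.range Sum.inr) (.inr (i, w)) (.inr (j, w')) := by
    obtain ⟨p, -, hd, hs⟩ := exists_walk_inr_inr (G := G) hij w w'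
    exact ⟨p, p.isPath_of_length_eq_dist hd, hd, hs⟩
  rintro _ ⟨⟨i, w⟩, rfl⟩ _ ⟨⟨j, w'⟩, rfl⟩
  rcases lt_trichotomy i j with h | rfl | h
  · exact hlt h w w'
  · by_cases hw : w = w'
    · subst hw
      exact ⟨.nil, by simp⟩
    by_cases hadj : G.Adj w w'
    · have h : (corona (pathGraph r) G).Adj (.inr (i, w)) (.inr (i, w')) := by simpa
      have hd : h.toWalk.length = (corona (pathGraph r) G).dist (.inr (i, w)) (.inr (i, w')) := by
        rw [dist_eq_one_iff_adj.2 h]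
        simp
      exact ⟨h.toWalk, Walk.isPath_of_length_eq_dist _ hd, hd, fun v hv _ => by simpa using hv⟩
    · have h₁ : (corona (pathGraph r) G).Adj (.inr (i, w)) (.inl i) := by simp
      have h₂ : (corona (pathGraph r) G).Adj (.inl i) (.inr (i, w')) := by simp
      have hd : (Walk.cons h₁ h₂.toWalk).length =
          (corona (pathGraph r) G).dist (.inr (i, w)) (.inr (i, w')) := by
        refine le_antisymm ?_ (dist_le _)
        have h0 : 0 < (corona (pathGraph r) G).dist (.inr (i, w)) (.inr (i, w')) :=
          (Walk.cons h₁ h₂.toWalk).reachable.pos_dist_of_ne (by simpa)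
        have h1 : (corona (pathGraph r) G).dist (.inr (i, w)) (.inr (i, w')) ≠ 1 := by
          rw [Ne, dist_eq_one_iff_adj]
          simpa
        simp only [Walk.length_cons, Walk.length_nil]
        omega
      refine ⟨_, Walk.isPath_of_length_eq_dist _ hd, hd, fun v hv hvS => ?_⟩
      obtain ⟨_, rfl⟩ := hvS
      simpa using hv
  · exact (hlt h w' w).symm

theorem ediam_corona_pathGraph [Nonempty W] (hr : 2 ≤ r) :
    (corona (pathGraph r) G).ediam = (r + 1 : ℕ) := by
  refine le_antisymm (ediam_le_of_edist_le fun x y => ?_) ?_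
  · obtain ⟨p, hp⟩ := exists_walk_inl_length_le_one (G := pathGraph r) (H := G) x
    obtain ⟨q, hq⟩ := exists_walk_inl_length_le_one (G := pathGraph r) (H := G) y
    obtain ⟨s, hs⟩ := exists_walk_inl_inl_length_lt (G := G) (coronaBase x) (coronaBase y)
    refine (edist_le ((p.append s).append q.reverse)).trans ?_
    rw [Walk.length_append, Walk.length_append, Walk.length_reverse]
    exact_mod_cast (by omega : p.length + s.length + q.length ≤ r + 1)
  · obtain ⟨w⟩ := ‹Nonempty W›
    obtain ⟨p, hl, hd, -⟩ := exists_walk_inr_inr (G := G)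
      (i := (⟨0, by omega⟩ : Fin r)) (j := ⟨r - 1, by omega⟩) (by simp; omega) w w
    have h : p.length = r + 1 := by
      rw [hl]
      simp only
      omega
    rw [← h, hd, p.reachable.coe_dist_eq_edist]
    exact edist_le_ediam

theorem mutualVisNum_corona_pathGraph [Fintype W] [Nonempty W] (hr : 2 ≤ r) :
    mutualVisNum (corona (pathGraph r) G) = r * Fintype.card W := by
  refine IsGreatest.csSup_eq ⟨⟨Finset.univ.map .inr, ?_, by simp⟩, ?_⟩
  · simpa using isMutualVisSet_range_inr
  · rintro _ ⟨S, hS, rfl⟩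
    simpa using hS.card_le_corona (by simpa) Fintype.card_pos

end CoronaPath

/-- For a finite graph `G` on `n ≥ 2` vertices and `r ≥ 3`,
`μ_{r+1}(P_r ⊙ G) = μ(P_r ⊙ G) = rn`, where `r + 1` is the diameter of `P_r ⊙ G`. -/
theorem stmt13 {W : Type*} [Fintype W] (G : SimpleGraph W) (n : ℕ)
    (hn : Fintype.card W = n) (hn2 : 2 ≤ n) (r : ℕ) (hr : 3 ≤ r) :
    (corona (SimpleGraph.pathGraph r) G).diam = r + 1 ∧
    kdistMu (corona (SimpleGraph.pathGraph r) G) (r + 1)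
      = mutualVisNum (corona (SimpleGraph.pathGraph r) G) ∧
    mutualVisNum (corona (SimpleGraph.pathGraph r) G) = r * n := by
  have : Nonempty W := Fintype.card_pos_iff.1 (by omega)
  have he := ediam_corona_pathGraph (G := G) (r := r) (by omega)
  have hd : (corona (SimpleGraph.pathGraph r) G).diam = r + 1 := by
    rw [diam, he, ENat.toNat_natCast]
  refine ⟨hd, ?_, hn ▸ mutualVisNum_corona_pathGraph (by omega)⟩
  rw [← hd]
  exact kdistMu_diam (he ▸ ENat.natCast_ne_top _)
end

section
/- Let G be a finite connected graph with girth g and let k be a positive integer with k < ⌊g/2⌋. If S is a k-distance mutual-visibility set of G with |S| ≥ 3, then S is an independent set of G (no two vertices of S are adjacent). -/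
open SimpleGraph

/-- In a finite connected graph of girth `g`, any `k`-distance mutual-visibility set of
size at least `3` with `k < ⌊g/2⌋` is independent. -/
theorem stmt14 {V : Type*} [Fintype V] (G : SimpleGraph V) (hG : G.Connected)
    (g k : ℕ) (hg : G.girth = g) (hk1 : 1 ≤ k) (hk : k < g / 2)
    (S : Finset V) (hS : IsKDistMutualVisSet G k ↑S) (hcard : 3 ≤ S.card) :
    ∀ x ∈ S, ∀ y ∈ S, ¬ G.Adj x y := by
  classical
  intro x hx y hy hxy
  obtain ⟨z, hz, hz'⟩ : ∃ z ∈ S, z ∉ ({x, y} : Finset V) :=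
    Finset.exists_mem_notMem_of_card_lt_card (Finset.card_le_two.trans_lt hcard)
  simp only [Finset.mem_insert, Finset.mem_singleton, not_or] at hz'
  obtain ⟨hzx, hzy⟩ := hz'
  obtain ⟨p, -, -, hpk, hp⟩ := hS hx hz
  obtain ⟨q, -, -, hqk, hq⟩ := hS hy hz
  have hyp : y ∉ p.support := fun h =>
    (hp y h hy).elim hxy.ne' (Ne.symm hzy)
  have hxq : x ∉ q.support := fun h =>
    (hq x h hx).elim hxy.ne (Ne.symm hzx)
  have hcycle : (Walk.cons hxy (q.append p.reverse).bypass).IsCycle := by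
    rw [Walk.cons_isCycle_iff]
    refine ⟨Walk.bypass_isPath _, fun h => ?_⟩
    have h' := Walk.edges_bypass_subset_edges _ h
    rw [Walk.edges_append, Walk.edges_reverse, List.mem_append, List.mem_reverse] at h'
    exact h'.elim (fun h => hxq (q.fst_mem_support_of_mem_edges h))
      (fun h => hyp (p.snd_mem_support_of_mem_edges h))
  have hgirth := girth_le_length hcycle
  have hlen := (q.append p.reverse).length_bypass_le_length
  rw [Walk.length_append, Walk.length_reverse] at hlen
  rw [Walk.length_cons, hg] at hgirth
  omega
end

section
/- Let G be a finite connected graph with girth g ≥ 6 and maximum degree Δ ≥ 3. Then the 2-distance mutual-visibility number of G satisfies μ_2(G) ≤ 1 + Δ(Δ−1). -/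
open SimpleGraph

/-- Two distinct `S_2`-visible vertices are adjacent or have a common neighbour outside `S`. -/
lemma SKVisible.adj_or_exists_common_neighbor {V : Type*} {G : SimpleGraph V} {S : Set V}
    {x y : V} (h : SKVisible G S 2 x y) (hxy : x ≠ y) :
    G.Adj x y ∨ ∃ u, G.Adj x u ∧ G.Adj u y ∧ u ∉ S := by
  obtain ⟨p, -, -, hlen, hS⟩ := h
  match p with
  | .nil => exact absurd rfl hxy
  | .cons hxy' .nil => exact .inl hxy'
  | .cons (v := u) hxu (.cons huy .nil) =>
    refine .inr ⟨u, hxu, huy, fun hu => ?_⟩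
    rcases hS u (by simp) hu with rfl | rfl
    · exact hxu.ne rfl
    · exact huy.ne rfl
  | .cons _ (.cons _ (.cons _ q)) =>
    simp only [Walk.length_cons] at hlen
    omega

/-- A `2`-distance mutual-visibility set has at most `1 + Δ * (Δ - 1)` elements
as soon as the maximum degree `Δ` is at least `2`. -/
lemma IsKDistMutualVisSet.card_le {V : Type*} [Fintype V] {G : SimpleGraph V}
    [DecidableRel G.Adj] (hΔ : 2 ≤ G.maxDegree) {S : Finset V}
    (hS : IsKDistMutualVisSet G 2 (S : Set V)) :
    S.card ≤ 1 + G.maxDegree * (G.maxDegree - 1) := by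
  classical
  obtain rfl | ⟨x, hx⟩ := S.eq_empty_or_nonempty
  · simp
  let f : V → Finset V := fun u => if u ∈ S then {u} else (G.neighborFinset u).erase x
  have hcover : S.erase x ⊆ (G.neighborFinset x).biUnion f := by
    intro y hy
    obtain ⟨hyx, hyS⟩ := Finset.mem_erase.1 hy
    rw [Finset.mem_biUnion]
    rcases (hS hx hyS).adj_or_exists_common_neighbor hyx.symm with hxy | ⟨u, hxu, huy, hu⟩
    · exact ⟨y, by simpa using hxy, by simp [f, hyS]⟩
    · exact ⟨u, by simpa using hxu, by simp_all [f]⟩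
  have hf : ∀ u ∈ G.neighborFinset x, (f u).card ≤ G.maxDegree - 1 := by
    intro u hu
    rw [mem_neighborFinset] at hu
    by_cases huS : u ∈ S
    · simp only [f, huS, if_true, Finset.card_singleton]
      omega
    · simp only [f, huS, if_false]
      rw [Finset.card_erase_of_mem (by simpa using hu.symm), card_neighborFinset_eq_degree]
      exact Nat.sub_le_sub_right (G.degree_le_maxDegree u) 1
  have hcard : (S.erase x).card ≤ G.maxDegree * (G.maxDegree - 1) :=
    calc (S.erase x).card ≤ ((G.neighborFinset x).biUnion f).card := Finset.card_le_card hcover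
      _ ≤ (G.neighborFinset x).card * (G.maxDegree - 1) := Finset.card_biUnion_le_card_mul _ _ _ hf
      _ ≤ G.maxDegree * (G.maxDegree - 1) := by
        rw [card_neighborFinset_eq_degree]
        exact Nat.mul_le_mul_right _ (G.degree_le_maxDegree x)
  have := Finset.card_erase_add_one hx
  omega

/-- If `G` is a finite connected graph with girth `g ≥ 6` and maximum degree `Δ ≥ 3`,
then `μ_2(G) ≤ 1 + Δ(Δ-1)`. -/
theorem stmt15 {V : Type*} [Fintype V] (G : SimpleGraph V) [DecidableRel G.Adj]
    (hG : G.Connected) (g Δ : ℕ) (hg : G.girth = g) (hg6 : 6 ≤ g)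
    (hΔ : G.maxDegree = Δ) (hΔ3 : 3 ≤ Δ) :
    kdistMu G 2 ≤ 1 + Δ * (Δ - 1) := by
  subst hΔ
  refine csSup_le ⟨0, ∅, by simp [IsKDistMutualVisSet], rfl⟩ ?_
  rintro n ⟨S, hS, rfl⟩
  exact hS.card_le (by omega)
end

section
/- Let G be a finite connected graph with odd girth g ≥ 5 and maximum degree Δ ≥ 2. If S is a ((g−1)/2)-distance mutual-visibility set of G such that the subgraph of G induced by S contains at least one edge, then |S| ≤ 2 + (Δ−1)^{(g−1)/2}. -/
open SimpleGraph

namespace SimpleGraph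

variable {V : Type*} {G : SimpleGraph V} {u v z : V}

/-- If `v` is adjacent to `u`, is no farther than `u` from `z`, and avoids some shortest
`u,z`-path, then there is a cycle of length at most `d(u,z) + d(v,z) + 1`. -/
lemma girth_le_dist_add_dist_add_one (hG : G.Connected) (huv : G.Adj u v)
    {p : G.Walk u z} (hp : p.IsPath) (hlen : p.length = G.dist u z) (hv : v ∉ p.support)
    (hle : G.dist v z ≤ G.dist u z) : G.girth ≤ G.dist u z + G.dist v z + 1 := by
  classical
  obtain ⟨q, hq, hql⟩ := hG.exists_path_of_dist v z
  have hu : u ∉ q.support := by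
    intro hu
    have hsplit := congrArg Walk.length (q.take_spec hu)
    rw [Walk.length_append] at hsplit
    have htake := dist_le (q.takeUntil u hu)
    have hdrop := dist_le (q.dropUntil u hu)
    have := hG.pos_dist_of_ne huv.ne'
    omega
  have hne : p ≠ Walk.cons huv q := by
    rintro rfl
    simp at hv
  obtain ⟨w, -, -, c, hc, hcl⟩ :=
    hp.exists_isCycle_length_le_add_of_ne ((Walk.cons_isPath_iff huv q).2 ⟨hq, hu⟩) hne
  have := girth_le_length hc
  rw [Walk.length_cons] at hcl
  omega

lemma Connected.exists_adj_dist_add_one_eq (hG : G.Connected) (hne : u ≠ z) :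
    ∃ w, G.Adj w z ∧ G.dist u w + 1 = G.dist u z := by
  obtain ⟨p, -, hp⟩ := hG.exists_path_of_dist z u
  cases p with
  | nil => exact absurd rfl hne
  | @cons _ w _ h q =>
    refine ⟨w, h.symm, ?_⟩
    rw [Walk.length_cons] at hp
    have h1 := dist_le q
    have h2 := hG.dist_triangle (u := z) (v := w) (w := u)
    have h3 := dist_eq_one_iff_adj.2 h
    rw [dist_comm (u := u), dist_comm (u := u)]
    omega

/-- At most `(Δ - 1) ^ i` vertices at distance `i` from `u` are no closer to a given neighbor
of `u`. -/
lemma card_filter_dist_eq_and_le_dist [Fintype V] [DecidableRel G.Adj] (hG : G.Connected)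
    (huv : G.Adj u v) (i : ℕ) :
    (Finset.univ.filter fun z ↦ G.dist u z = i ∧ i ≤ G.dist v z).card ≤
      (G.maxDegree - 1) ^ i := by
  classical
  induction i with
  | zero =>
    rw [pow_zero, Finset.card_le_one]
    simp only [Finset.mem_filter, Finset.mem_univ, true_and, hG.dist_eq_zero_iff]
    rintro a ⟨rfl, -⟩ b ⟨rfl, -⟩
    rfl
  | succ i ih =>
    set B : ℕ → Finset V := fun i ↦
      Finset.univ.filter fun z ↦ G.dist u z = i ∧ i ≤ G.dist v z with hB
    have mem_B (i : ℕ) (z : V) : z ∈ B i ↔ G.dist u z = i ∧ i ≤ G.dist v z := by simp [hB]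
    have hsub : B (i + 1) ⊆ (B i).biUnion fun w ↦ G.neighborFinset w ∩ B (i + 1) := by
      intro z hz
      have hz' := (mem_B _ _).1 hz
      have hne : u ≠ z := by
        rintro rfl
        simp at hz'
      obtain ⟨w, hwz, hw⟩ := hG.exists_adj_dist_add_one_eq hne
      have h1 := hG.dist_triangle (u := v) (v := w) (w := z)
      have h2 := dist_eq_one_iff_adj.2 hwz
      simp only [Finset.mem_biUnion, Finset.mem_inter, mem_neighborFinset]
      exact ⟨w, (mem_B _ _).2 ⟨by omega, by omega⟩, hwz, hz⟩
    have hnbr : ∀ w ∈ B i, (G.neighborFinset w ∩ B (i + 1)).card ≤ G.maxDegree - 1 := by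
      intro w hw
      have hw' := (mem_B _ _).1 hw
      obtain ⟨x, hx, hxB⟩ : ∃ x, G.Adj w x ∧ x ∉ B (i + 1) := by
        rcases eq_or_ne u w with rfl | hne
        · exact ⟨v, huv, fun h ↦ by simp [mem_B] at h⟩
        · obtain ⟨x, hxw, hx⟩ := hG.exists_adj_dist_add_one_eq hne
          exact ⟨x, hxw.symm, fun h ↦ by have := (mem_B _ _).1 h; omega⟩
      have hlt : (G.neighborFinset w ∩ B (i + 1)).card < (G.neighborFinset w).card :=
        Finset.card_lt_card <| (Finset.ssubset_iff_of_subset Finset.inter_subset_left).2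
          ⟨x, by simpa using hx, fun h ↦ hxB (Finset.mem_inter.1 h).2⟩
      rw [card_neighborFinset_eq_degree] at hlt
      have := G.degree_le_maxDegree w
      omega
    calc (B (i + 1)).card
        ≤ _ := Finset.card_le_card hsub
      _ ≤ (B i).card * (G.maxDegree - 1) := Finset.card_biUnion_le_card_mul _ _ _ hnbr
      _ ≤ (G.maxDegree - 1) ^ (i + 1) := by
        rw [pow_succ]
        exact Nat.mul_le_mul_right _ ih

end SimpleGraph

/-- If `G` is a finite connected graph with odd girth `g ≥ 5` and maximum degree `Δ ≥ 2`,
and `S` is a `(g-1)/2`-distance mutual-visibility set whose induced subgraph contains an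
edge, then `|S| ≤ 2 + (Δ-1)^((g-1)/2)`. -/
theorem stmt17 {V : Type*} [Fintype V] (G : SimpleGraph V) [DecidableRel G.Adj]
    (hG : G.Connected) (g Δ : ℕ) (hg : G.girth = g) (hodd : Odd g) (hg5 : 5 ≤ g)
    (hΔ : G.maxDegree = Δ) (hΔ2 : 2 ≤ Δ)
    (S : Finset V) (hS : IsKDistMutualVisSet G ((g - 1) / 2) ↑S)
    (hedge : ∃ x ∈ S, ∃ y ∈ S, G.Adj x y) :
    S.card ≤ 2 + (Δ - 1) ^ ((g - 1) / 2) := by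
  classical
  subst hg hΔ
  obtain ⟨k, hk⟩ := hodd
  have hk' : (G.girth - 1) / 2 = k := by omega
  rw [hk'] at hS ⊢
  obtain ⟨u, hu, v, hv, huv⟩ := hedge
  have hdist : ∀ z ∈ S, z ≠ u → z ≠ v → G.dist u z = k ∧ G.dist v z = k := by
    intro z hz hzu hzv
    obtain ⟨p, hp, hpl, hpk, hpS⟩ := hS hu hz
    obtain ⟨q, hq, hql, hqk, hqS⟩ := hS hv hz
    rcases le_total (G.dist v z) (G.dist u z) with hle | hle
    · have := girth_le_dist_add_dist_add_one hG huv hp hpl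
        (fun h ↦ (hpS v h hv).elim huv.ne' hzv.symm) hle
      omega
    · have := girth_le_dist_add_dist_add_one hG huv.symm hq hql
        (fun h ↦ (hqS u h hu).elim huv.ne hzu.symm) hle
      omega
  have hsub : S ⊆ {u, v} ∪ Finset.univ.filter fun z ↦ G.dist u z = k ∧ k ≤ G.dist v z := by
    intro z hz
    by_cases hzu : z = u
    · simp [hzu]
    by_cases hzv : z = v
    · simp [hzv]
    have := hdist z hz hzu hzv
    simp [this]
  calc S.card ≤ _ := Finset.card_le_card hsub
    _ ≤ _ := Finset.card_union_le _ _
    _ ≤ 2 + (G.maxDegree - 1) ^ k :=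
      Nat.add_le_add Finset.card_le_two (card_filter_dist_eq_and_le_dist hG huv k)
end
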